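/- arXiv:1004.0371 — 3 statements merged into one kernel-verified Lean document; each statement's English description precedes it below -/
import Mathlib

section
/- Let L be a complex Lie algebra which is also a finite-dimensional normed ℂ-vector space (with the same scalar multiplication), let V be a finite-dimensional normed ℂ-vector space, let T : V → V be a ℂ-linear map, let n be a natural number, and let f : L → V be n-times continuously ℂ-differentiable. Suppose E, h ∈ L and c ∈ ℂ satisfy ⁅E, h⁆ = (−c)•E, and suppose f is infinitesimally equivariant in the direction E, i.e. T(f(Y)) = (fderiv ℂ f Y)(⁅E, Y⁆) for all Y ∈ L. Then T^n(f(h)) = (−c)^n • iteratedDeriv n (fun t : ℂ => f (h + t•E)) 0; that is, the n-fold application of T to f(h) equals (−c)^n times the n-th derivative at t = 0 of the function t ↦ f(h + tE). -/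
/-- A complex Lie ring which is also a normed additive group
(with the same underlying additive group). -/
class NormedLieRing (L : Type*) extends LieRing L, NormedAddCommGroup L

/-- A complex Lie algebra which is also a normed ℂ-vector space
(with the same scalar multiplication). -/
class NormedLieAlgebra (L : Type*) [NormedLieRing L] extends LieAlgebra ℂ L, NormedSpace ℂ L

theorem aux_pow {V : Type*} [NormedAddCommGroup V] [NormedSpace ℂ V]
    (T : V →L[ℂ] V) (a : ℂ) (g : ℂ → V) (n : ℕ) (hg : ContDiff ℂ n g)
    (hT : ∀ t, T (g t) = a • deriv g t) :
    ∀ k ≤ n, ∀ t, ((T : V →ₗ[ℂ] V) ^ k) (g t) = a ^ k • iteratedDeriv k g t := by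
  intro k
  induction k with
  | zero => intro _ t; simp
  | succ k ih =>
    intro hk t
    rw [pow_succ', Module.End.mul_apply, ih (by omega) t, map_smul, pow_succ, mul_smul]
    congr 1
    have hgk : ContDiff ℂ k g := hg.of_le (by exact_mod_cast (by omega : k ≤ n))
    have h1 : iteratedDeriv k (fun s => T (g s)) t = T (iteratedDeriv k g t) := by
      have := T.iteratedFDeriv_comp_left (x := t) hgk.contDiffAt (i := k) le_rfl
      simp only [iteratedDeriv]
      have h2 : (fun s => T (g s)) = T ∘ g := rfl
      rw [h2, this]
      rfl
    have h3 : (fun s => T (g s)) = fun s => a • deriv g s := funext hT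
    rw [ContinuousLinearMap.coe_coe, ← h1, h3, iteratedDeriv_succ', ]
    exact iteratedDeriv_fun_const_smul_field a (deriv g)

/-- For an infinitesimally equivariant `n`-times continuously differentiable map `f : L → V`
(`T(f Y) = (Df)_Y [E,Y]`) and `[E,h] = (-c)•E`, one has
`Tⁿ(f h) = (-c)ⁿ • (dⁿ/dtⁿ)|₀ f(h + tE)`. -/
theorem iterated_action_eq_iteratedDeriv {L : Type*} [NormedLieRing L] [NormedLieAlgebra L]
    [FiniteDimensional ℂ L]
    {V : Type*} [NormedAddCommGroup V] [NormedSpace ℂ V] [FiniteDimensional ℂ V]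
    (T : V →ₗ[ℂ] V) (n : ℕ) (f : L → V) (hf : ContDiff ℂ n f)
    (E h : L) (c : ℂ) (hEh : ⁅E, h⁆ = (-c) • E)
    (hequiv : ∀ Y : L, T (f Y) = fderiv ℂ f Y ⁅E, Y⁆) :
    (T ^ n) (f h) = (-c) ^ n • iteratedDeriv n (fun t : ℂ => f (h + t • E)) 0 := by
  rcases Nat.eq_zero_or_pos n with rfl | hn
  · simp
  have hfd : Differentiable ℂ f := hf.differentiable (by exact_mod_cast hn.ne')
  have hline : ∀ t : ℂ, HasDerivAt (fun t : ℂ => h + t • E) E t := by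
    intro t
    simpa using ((hasDerivAt_id t).smul_const E).const_add h
  have hg : ContDiff ℂ n (fun t : ℂ => f (h + t • E)) :=
    hf.comp (contDiff_const.add (contDiff_id.smul contDiff_const))
  have hd : ∀ t : ℂ, deriv (fun t : ℂ => f (h + t • E)) t = fderiv ℂ f (h + t • E) E := by
    intro t
    exact ((hfd (h + t • E)).hasFDerivAt.comp_hasDerivAt t (hline t)).deriv
  have hT : ∀ t : ℂ, (LinearMap.toContinuousLinearMap T) (f (h + t • E))
      = (-c) • deriv (fun t : ℂ => f (h + t • E)) t := by
    intro t
    have hb : ⁅E, h + t • E⁆ = (-c) • E := by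
      rw [lie_add, lie_smul, lie_self, smul_zero, add_zero, hEh]
    rw [hd, LinearMap.coe_toContinuousLinearMap', hequiv, hb]
    exact map_smul _ _ _
  have := aux_pow _ (-c) _ n hg hT n le_rfl 0
  simpa using this
end

section
/- Let L be a finite-dimensional complex semisimple Lie algebra (a finite-dimensional complex Lie algebra whose Killing form is nondegenerate), equipped with a norm making it a normed ℂ-vector space; let H ⊆ L be a Cartan subalgebra; let V be a finite-dimensional normed ℂ-vector space carrying a Lie module structure over L. Suppose f : L → V is a polynomial map, i.e., there exist v₁, …, v_k ∈ V and functions p₁, …, p_k : L → ℂ lying in the ℂ-subalgebra of the algebra of functions L → ℂ generated by the linear functionals on L, such that f(Y) = Σᵢ pᵢ(Y)•vᵢ for all Y; and suppose f is infinitesimally equivariant: ⁅X, f(Y)⁆ = (fderiv ℂ f Y)(⁅X, Y⁆) for all X, Y ∈ L. If f(h) = 0 for every h ∈ H, then f = 0. -/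
/-- Existence of a regular element: `L = H + [L, h₀]`. -/
lemma exists_regular_aux {L : Type*} [LieRing L] [LieAlgebra ℂ L] [FiniteDimensional ℂ L]
    (hss : (killingForm ℂ L).Nondegenerate)
    (H : LieSubalgebra ℂ L) (hH : H.IsCartanSubalgebra) :
    ∃ h₀ : H, ∀ y : L, ∃ (X : L) (h : L), h ∈ H ∧ ⁅X, (h₀ : L)⁆ + h = y := by
  have := hH
  have : LieAlgebra.IsKilling ℂ L := by
    constructor
    rw [← LieSubmodule.toSubmodule_inj]
    exact (LieIdeal.coe_killingCompl_top ℂ L).trans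
      (LinearMap.separatingLeft_iff_ker_eq_bot.mp hss.1)
  obtain ⟨h₀, hh₀⟩ := Module.Dual.exists_forall_ne_zero_of_forall_exists
    (K := ℂ) (M := H) (ι := {α : LieModule.Weight ℂ H L // α.IsNonZero})
    (fun α => LieModule.Weight.toLinear ℂ H L α.1) (by
      rintro ⟨α, hα⟩
      by_contra! hc
      apply hα
      funext x
      exact hc x)
  refine ⟨h₀, ?_⟩
  let S : Submodule ℂ L := LinearMap.range (LieAlgebra.ad ℂ L (h₀ : L)) ⊔ H.toSubmodule
  have hS : S = ⊤ := by
    rw [eq_top_iff]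
    have h1 := LieModule.iSup_genWeightSpace_eq_top' ℂ H L
    have h2 : (⨆ α : LieModule.Weight ℂ H L,
        (LieModule.genWeightSpace L (α : H → ℂ)).toSubmodule) = ⊤ := by
      rw [← LieSubmodule.iSup_toSubmodule, h1]; rfl
    rw [← h2]
    refine iSup_le fun α => ?_
    intro x hx
    by_cases hα : α.IsZero
    · refine Submodule.mem_sup_right ?_
      have hx' : x ∈ LieAlgebra.rootSpace H (0 : H → ℂ) := by
        have : (α : H → ℂ) = 0 := hα
        rw [this] at hx
        exact hx
      rw [LieAlgebra.rootSpace_zero_eq] at hx'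
      exact hx'
    · refine Submodule.mem_sup_left ?_
      have hne : (α : H → ℂ) h₀ ≠ 0 := hh₀ ⟨α, hα⟩
      have := LieAlgebra.IsKilling.lie_eq_smul_of_mem_rootSpace (H := H) hx h₀
      refine ⟨((α : H → ℂ) h₀)⁻¹ • x, ?_⟩
      rw [map_smul]
      change ((α : H → ℂ) h₀)⁻¹ • ⁅h₀, x⁆ = x
      rw [this, smul_smul, inv_mul_cancel₀ hne, one_smul]
  intro y
  have hy : y ∈ S := hS ▸ Submodule.mem_top
  obtain ⟨_, ⟨x, rfl⟩, h, hh, rfl⟩ := Submodule.mem_sup.mp hy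
  refine ⟨-x, h, hh, ?_⟩
  rw [neg_lie, lie_skew, LieAlgebra.ad_apply]

/-- The adjoint action as a continuous linear map. -/
noncomputable def adCLM (L : Type*) [NormedLieRing L] [NormedLieAlgebra L]
    [FiniteDimensional ℂ L] : L →L[ℂ] (L →L[ℂ] L) :=
  LinearMap.toContinuousLinearMap
    ((LinearMap.toContinuousLinearMap (E := L) (F' := L) (𝕜 := ℂ)).toLinearMap ∘ₗ
      (LieAlgebra.ad ℂ L : L →ₗ[ℂ] Module.End ℂ L))

lemma adCLM_apply {L : Type*} [NormedLieRing L] [NormedLieAlgebra L]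
    [FiniteDimensional ℂ L] (X Y : L) : adCLM L X Y = ⁅X, Y⁆ := rfl

/-- Vanishing along the orbits. -/
lemma vanish_orbit_aux {L : Type*} [NormedLieRing L]
    [NormedLieAlgebra L] [FiniteDimensional ℂ L]
    {V : Type*} [NormedAddCommGroup V] [NormedSpace ℂ V] [FiniteDimensional ℂ V]
    [LieRingModule L V] [LieModule ℂ L V]
    (f : L → V) (hf : Differentiable ℂ f)
    (hequiv : ∀ X Y : L, ⁅X, f Y⁆ = fderiv ℂ f Y ⁅X, Y⁆)
    (h : L) (hh : f h = 0) (X : L) : f (NormedSpace.exp (adCLM L X) h) = 0 := by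
  have : CompleteSpace L := FiniteDimensional.complete ℂ L
  have : CompleteSpace V := FiniteDimensional.complete ℂ V
  let ρ : V →L[ℂ] V := LinearMap.toContinuousLinearMap (LieModule.toEnd ℂ L V X)
  have hρ : ∀ v, ρ v = ⁅X, v⁆ := fun v => rfl
  let g : ℂ → L := fun t => NormedSpace.exp (t • adCLM L X) h
  have hg : ∀ t, HasDerivAt g ⁅X, g t⁆ t := by
    intro t
    have := (hasDerivAt_exp_smul_const' (𝕂 := ℂ) (adCLM L X) t).clm_apply (hasDerivAt_const t h)
    simpa [g, adCLM_apply] using this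
  have hu : ∀ t, HasDerivAt (fun t => f (g t)) (ρ (f (g t))) t := by
    intro t
    rw [hρ, hequiv]
    exact (hf (g t)).hasFDerivAt.comp_hasDerivAt t (hg t)
  have hw : ∀ t, HasDerivAt (fun t : ℂ => NormedSpace.exp (t • (-ρ)) (f (g t))) 0 t := by
    intro t
    have := (hasDerivAt_exp_smul_const (𝕂 := ℂ) (-ρ) t).clm_apply (hu t)
    simpa using this
  have hc := is_const_of_deriv_eq_zero (fun t => (hw t).differentiableAt)
    (fun t => (hw t).deriv) 1 0
  have hz : NormedSpace.exp (-ρ) (f (g 1)) = 0 := by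
    simpa [g, hh] using hc
  have hi : NormedSpace.exp ρ * NormedSpace.exp (-ρ) = 1 := by
    let : NormedAlgebra ℚ (V →L[ℂ] V) := NormedAlgebra.restrictScalars ℚ ℂ _
    rw [← NormedSpace.exp_add_of_commute (Commute.neg_right (Commute.refl ρ))]
    simp
  have : f (g 1) = (NormedSpace.exp ρ * NormedSpace.exp (-ρ)) (f (g 1)) := by rw [hi]; rfl
  have h2 : f (g 1) = NormedSpace.exp ρ (NormedSpace.exp (-ρ) (f (g 1))) := this
  rw [hz, map_zero] at h2
  simpa [g] using h2

/-- A polynomial, infinitesimally equivariant map `f : L → V` from a finite-dimensional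
complex semisimple Lie algebra (nondegenerate Killing form) which vanishes on a Cartan
subalgebra `H` vanishes identically. -/
theorem equivariant_polynomial_vanishing_on_cartan {L : Type*} [NormedLieRing L]
    [NormedLieAlgebra L] [FiniteDimensional ℂ L]
    (hss : (killingForm ℂ L).Nondegenerate)
    (H : LieSubalgebra ℂ L) (hH : H.IsCartanSubalgebra)
    {V : Type*} [NormedAddCommGroup V] [NormedSpace ℂ V] [FiniteDimensional ℂ V]
    [LieRingModule L V] [LieModule ℂ L V]
    (f : L → V)
    (hpoly : ∃ (k : ℕ) (v : Fin k → V) (p : Fin k → (L → ℂ)),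
      (∀ i, p i ∈ Algebra.adjoin ℂ {g : L → ℂ | IsLinearMap ℂ g}) ∧
      ∀ Y : L, f Y = ∑ i, p i Y • v i)
    (hequiv : ∀ X Y : L, ⁅X, f Y⁆ = fderiv ℂ f Y ⁅X, Y⁆)
    (hvanish : ∀ h ∈ H, f h = 0) :
    ∀ Y : L, f Y = 0 := by
  have : CompleteSpace L := FiniteDimensional.complete ℂ L
  have han : AnalyticOnNhd ℂ f Set.univ := by
    obtain ⟨k, v, p, hp, hfp⟩ := hpoly
    have hpa : ∀ q ∈ Algebra.adjoin ℂ {g : L → ℂ | IsLinearMap ℂ g},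
        AnalyticOnNhd ℂ q Set.univ := by
      intro q hq
      induction hq using Algebra.adjoin_induction with
      | mem x hx =>
        exact (LinearMap.toContinuousLinearMap (IsLinearMap.mk' x hx)).analyticOnNhd _
      | algebraMap r => exact analyticOnNhd_const
      | add x y _ _ hx hy => exact hx.add hy
      | mul x y _ _ hx hy => exact hx.mul hy
    have : f = fun Y => ∑ i, p i Y • v i := funext hfp
    rw [this]
    exact Finset.analyticOnNhd_fun_sum _
      fun i _ => (hpa _ (hp i)).smul analyticOnNhd_const
  have hdiff : Differentiable ℂ f := fun x => (han x trivial).differentiableAt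
  obtain ⟨h₀, hreg⟩ := exists_regular_aux hss H hH
  let Φ : L × H.toSubmodule → L := fun z => NormedSpace.exp (adCLM L z.1) (z.2 : L)
  have hΦz : ∀ z, f (Φ z) = 0 := fun z =>
    vanish_orbit_aux f hdiff hequiv _ (hvanish _ z.2.2) _
  let z₀ : L × H.toSubmodule := (0, h₀)
  have hexp : HasStrictFDerivAt (fun z : L × H.toSubmodule => NormedSpace.exp (adCLM L z.1))
      ((1 : (L →L[ℂ] L) →L[ℂ] (L →L[ℂ] L)).comp
        ((adCLM L).comp (ContinuousLinearMap.fst ℂ L H.toSubmodule))) z₀ := by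
    have h1 : HasStrictFDerivAt (NormedSpace.exp : (L →L[ℂ] L) → (L →L[ℂ] L))
        (1 : (L →L[ℂ] L) →L[ℂ] (L →L[ℂ] L)) (adCLM L z₀.1) := by
      have : adCLM L z₀.1 = 0 := map_zero _
      rw [this]
      exact hasStrictFDerivAt_exp_zero
    exact h1.comp z₀ ((adCLM L).comp
      (ContinuousLinearMap.fst ℂ L H.toSubmodule)).hasStrictFDerivAt
  have hΦ := hexp.clm_apply ((H.toSubmodule.subtypeL.comp
    (ContinuousLinearMap.snd ℂ L H.toSubmodule)).hasStrictFDerivAt (x := z₀))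
  have hsurj := hΦ.map_nhds_eq_of_surj (by
    rw [LinearMap.range_eq_top]
    intro y
    obtain ⟨X, h, hh, rfl⟩ := hreg y
    refine ⟨(X, ⟨h, hh⟩), ?_⟩
    simp [z₀, adCLM_apply, add_comm])
  have hev : f =ᶠ[nhds (Φ z₀)] fun _ => 0 := by
    change ∀ᶠ y in nhds (Φ z₀), f y = 0
    have : nhds (Φ z₀) = Filter.map Φ (nhds z₀) := hsurj.symm
    rw [this, Filter.eventually_map]
    exact Filter.Eventually.of_forall hΦz
  intro Y
  exact congrFun (han.eq_of_eventuallyEq analyticOnNhd_const hev) Y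
end

section
/- Let U be an associative unital ℂ-algebra, V a ℂ-vector space with an algebra representation π : U →ₐ[ℂ] End_ℂ(V), and f : U → V a ℂ-linear map. Let E ∈ U, let K ∈ U be invertible, let x ∈ U, and let c, d ∈ ℂ satisfy: K*E = d•(E*K), x*E = c•(E*x), and K*x = x*K. Suppose that for every X ∈ U: π(E)(f(X)) = f(E*X) − f(K*X*E*K⁻¹). Then for every natural number n: π(E)^n(f(x)) = (∏_{k=1}^{n} (1 − d^k·c)) • f(E^n * x). -/
/-- The core computation for trace functions on a quantum group: if
`K E = d (E K)`, `x E = c (E x)`, `K x = x K`, and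
`π(E)(f X) = f(E X) - f(K X E K⁻¹)` for all `X`, then
`π(E)ⁿ (f x) = ∏_{k=1}^n (1 - dᵏ c) • f(Eⁿ x)`. -/
theorem quantum_divisibility {U : Type*} [Ring U] [Algebra ℂ U]
    {V : Type*} [AddCommGroup V] [Module ℂ V]
    (π : U →ₐ[ℂ] Module.End ℂ V) (f : U →ₗ[ℂ] V)
    (E : U) (K : Uˣ) (x : U) (c d : ℂ)
    (hK : (K : U) * E = d • (E * (K : U)))
    (hx : x * E = c • (E * x))
    (hKx : (K : U) * x = x * (K : U))
    (hf : ∀ X : U, π E (f X) = f (E * X) - f ((K : U) * X * E * ((K⁻¹ : Uˣ) : U))) :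
    ∀ n : ℕ, (π E ^ n) (f x) = (∏ k ∈ Finset.Icc 1 n, (1 - d ^ k * c)) • f (E ^ n * x) := by
  have hpow : ∀ n : ℕ, (K : U) * E ^ n = d ^ n • (E ^ n * (K : U)) := by
    intro n
    induction n with
    | zero => simp
    | succ n ih =>
      rw [pow_succ, ← mul_assoc, ih, smul_mul_assoc, mul_assoc, hK, mul_smul_comm, smul_smul,
        ← mul_assoc, pow_succ]
  have key : ∀ n : ℕ, (K : U) * (E ^ n * x) * E * ((K⁻¹ : Uˣ) : U)
      = (d ^ (n + 1) * c) • (E ^ (n + 1) * x) := by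
    intro n
    have h1 : (K : U) * (E ^ n * x) * E = c • ((K : U) * E ^ (n + 1) * x) := by
      rw [mul_assoc, mul_assoc (E ^ n), hx, mul_smul_comm, mul_smul_comm, ← mul_assoc (E ^ n),
        ← pow_succ, ← mul_assoc]
    rw [h1, hpow, smul_mul_assoc (d ^ (n + 1)), mul_assoc (E ^ (n + 1)), hKx, ← mul_assoc, smul_smul,
      smul_mul_assoc,
      Units.mul_inv_cancel_right, mul_comm c]
  intro n
  induction n with
  | zero => simp
  | succ n ih =>
    rw [pow_succ', Module.End.mul_apply, ih, map_smul, hf, key, ← mul_assoc, ← pow_succ',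
      map_smul, Finset.prod_Icc_succ_top (by omega), ← smul_smul _ (1 - _),
      sub_smul, one_smul]
end
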